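/- Let D̄₁ := {x ∈ D₁ : η(x) = 0}. Then φ(D̄₁) = D̄₁, and either D₁ = D̄₁ (i.e. η vanishes on D₁) or ξ ∈ D₁, in which case D₁ is the orthogonal direct sum of the line spanned by ξ and D̄₁. -/

import Mathlib

open RealInnerProductSpace

/-- With `D̄₁ = {x ∈ D₁ : η x = 0}` one has `φ(D̄₁) = D̄₁`, and either `D₁ = D̄₁`
or `ξ ∈ D₁`, in which case `D₁` is the orthogonal direct sum of `ℝ·ξ` and `D̄₁`. -/
theorem D1_dichotomy
    {V : Type*} [NormedAddCommGroup V] [InnerProductSpace ℝ V] [FiniteDimensional ℝ V]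
    (φ : V →ₗ[ℝ] V) (ξ : V) (hξ : ‖ξ‖ = 1)
    (hφ2 : ∀ x : V, φ (φ x) = -x + ⟪x, ξ⟫ • ξ)
    (hmet : ∀ x y : V, ⟪φ x, φ y⟫ = ⟪x, y⟫ - ⟪x, ξ⟫ * ⟪y, ξ⟫)
    (W D1 D2 : Submodule ℝ V)
    (hD1W : D1 ≤ W) (hD2W : D2 ≤ W)
    (hperp : ∀ x ∈ D1, ∀ y ∈ D2, ⟪x, y⟫ = 0)
    (hsum : D1 ⊔ D2 = W)
    (hφD1 : ∀ x ∈ D1, φ x ∈ D1)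
    (D1bar : Submodule ℝ V) (hD1bar : D1bar = D1 ⊓ (Submodule.span ℝ {ξ})ᗮ) :
    ((∀ x ∈ D1bar, φ x ∈ D1bar) ∧ (∀ y ∈ D1bar, ∃ x ∈ D1bar, φ x = y)) ∧
      (D1 = D1bar ∨
        (ξ ∈ D1 ∧ D1 = Submodule.span ℝ {ξ} ⊔ D1bar ∧ ∀ x ∈ D1bar, ⟪ξ, x⟫ = 0)) := by
  have hξξ : ⟪ξ, ξ⟫ = (1 : ℝ) := by
    rw [real_inner_self_eq_norm_sq, hξ]; norm_num
  have hξ0 : ξ ≠ 0 := by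
    intro h
    rw [h, norm_zero] at hξ
    exact zero_ne_one hξ
  have hφξ : φ ξ = 0 := by
    have h := hmet ξ ξ
    rw [hξξ] at h
    apply inner_self_eq_zero (𝕜 := ℝ).1
    rw [h]; norm_num
  have hη : ∀ x, ⟪φ x, ξ⟫ = (0 : ℝ) := by
    intro x
    have h1 := hφ2 (φ x)
    rw [hφ2 x, map_add, map_neg, map_smul, hφξ, smul_zero, add_zero] at h1
    have h2 : ⟪φ x, ξ⟫ • ξ = 0 := by
      have h3 : -φ x + 0 = -φ x + ⟪φ x, ξ⟫ • ξ := by rw [add_zero]; exact h1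
      exact (add_left_cancel h3).symm
    exact (smul_eq_zero.1 h2).resolve_right hξ0
  have hmem : ∀ x, x ∈ D1bar ↔ x ∈ D1 ∧ ⟪x, ξ⟫ = (0 : ℝ) := by
    intro x
    rw [hD1bar, Submodule.mem_inf, Submodule.mem_orthogonal_singleton_iff_inner_left]
  have hφbar : ∀ x ∈ D1bar, φ x ∈ D1bar := fun x hx =>
    (hmem _).2 ⟨hφD1 x ((hmem x).1 hx).1, hη x⟩
  refine ⟨⟨hφbar, fun y hy => ⟨-φ y, D1bar.neg_mem (hφbar y hy), ?_⟩⟩, ?_⟩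
  · rw [map_neg, hφ2, ((hmem y).1 hy).2, zero_smul, add_zero, neg_neg]
  by_cases hall : ∀ x ∈ D1, ⟪x, ξ⟫ = (0 : ℝ)
  · left
    ext x
    rw [hmem]
    exact ⟨fun h => ⟨h, hall x h⟩, fun h => h.1⟩
  · right
    push Not at hall
    obtain ⟨x, hx, hne⟩ := hall
    have hξD : ξ ∈ D1 := by
      have h1 : ⟪x, ξ⟫ • ξ ∈ D1 := by
        have h2 : ⟪x, ξ⟫ • ξ = φ (φ x) + x := by rw [hφ2]; abel
        rw [h2]
        exact D1.add_mem (hφD1 _ (hφD1 _ hx)) hx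
      exact (D1.smul_mem_iff hne).1 h1
    refine ⟨hξD, le_antisymm ?_ ?_, ?_⟩
    · intro y hy
      refine Submodule.mem_sup.2 ⟨⟪y, ξ⟫ • ξ,
        Submodule.smul_mem _ _ (Submodule.mem_span_singleton_self ξ),
        y - ⟪y, ξ⟫ • ξ, (hmem _).2 ⟨D1.sub_mem hy (D1.smul_mem _ hξD), ?_⟩, by abel⟩
      rw [inner_sub_left, real_inner_smul_left, hξξ]; ring
    · refine sup_le ?_ fun y hy => ((hmem y).1 hy).1
      rw [Submodule.span_singleton_le_iff_mem]
      exact hξD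
    · intro y hy
      rw [real_inner_comm]
      exact ((hmem y).1 hy).2
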